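/- Let A = ⟨a_1,…,a_{3m}⟩ be a sequence of positive integers and B a positive integer with B/4 < a_i < B/2 for all i and Σ a_i = mB, let T be an arbitrary tree on m nodes, and let (G', S, t) be the derived Hexasort instance on the connected tree-of-gadgets graph G' with t = B+4. Then S is emptyable on (G', t) if and only if the index set {1,…,3m} can be partitioned into m triples each of whose corresponding values a_i sum to exactly B. -/

import Mathlib

open scoped Classical

namespace Hexasort

/-- A board configuration: each vertex holds either a stack `(color, height)` or nothing. -/
abbrev Config (V C : Type*) := V → Option (C × ℕ)

/-- The everywhere-empty configuration. -/
def emptyConfig (V C : Type*) : Config V C := fun _ => none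

/-- The height contributed by a board entry to color `c` (0 if empty or another color). -/
noncomputable def colorHeight {C : Type*} (e : Option (C × ℕ)) (c : C) : ℕ :=
  match e with
  | none => 0
  | some (c', h) => if c' = c then h else 0

/-- Total height of the color-`c` stacks on the neighbors of `x`. -/
noncomputable def neighborSum {V C : Type*} [Fintype V] (G : SimpleGraph V)
    (δ : Config V C) (c : C) (x : V) : ℕ :=
  ∑ y ∈ Finset.univ.filter (fun y => G.Adj x y), colorHeight (δ y) c

/-- The configuration resulting from placing the stack `s` on the vertex `x`:
all same-colored neighbors are emptied, and `x` gets the merged stack unless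
its total height reaches the threshold `t`, in which case `x` becomes empty. -/
noncomputable def place {V C : Type*} [Fintype V] (G : SimpleGraph V) (t : ℕ)
    (δ : Config V C) (s : C × ℕ) (x : V) : Config V C :=
  fun v =>
    if v = x then
      (if t ≤ s.2 + neighborSum G δ s.1 x then none
       else some (s.1, s.2 + neighborSum G δ s.1 x))
    else if G.Adj x v ∧ (∃ hh, δ v = some (s.1, hh)) then none
    else δ v

/-- Play a sequence of stacks on a sequence of vertices, starting from `δ`. -/
noncomputable def play {V C : Type*} [Fintype V] (G : SimpleGraph V) (t : ℕ) :
    Config V C → List (C × ℕ) → List V → Config V C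
  | δ, [], _ => δ
  | δ, _ :: _, [] => δ
  | δ, s :: S, x :: p => play G t (place G t δ s x) S p

/-- Legality of playing the stacks `S` on the vertices `p`, starting from `δ`:
each stack is placed on a vertex that is empty at that moment. -/
inductive Legal {V C : Type*} [Fintype V] (G : SimpleGraph V) (t : ℕ) :
    Config V C → List (C × ℕ) → List V → Prop
  | nil (δ : Config V C) : Legal G t δ [] []
  | cons {δ : Config V C} (s : C × ℕ) (S : List (C × ℕ)) (x : V) (p : List V) :
      δ x = none → Legal G t (place G t δ s x) S p →
      Legal G t δ (s :: S) (x :: p)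

/-- `S` is fittable on `(G, t)`: all stacks can be placed in order. -/
def Fittable {V C : Type*} [Fintype V] (G : SimpleGraph V) (t : ℕ)
    (S : List (C × ℕ)) : Prop :=
  ∃ p : List V, Legal G t (emptyConfig V C) S p

/-- `S` is emptyable on `(G, t)`: all stacks can be placed in order so that the
final configuration is everywhere empty. -/
def Emptyable {V C : Type*} [Fintype V] (G : SimpleGraph V) (t : ℕ)
    (S : List (C × ℕ)) : Prop :=
  ∃ p : List V, Legal G t (emptyConfig V C) S p ∧
    play G t (emptyConfig V C) S p = emptyConfig V C

end Hexasort

namespace Hexasort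

/-- The vertices of the ten-vertex gadget graph `H`: a center `x`, a leaf `s` adjacent
to the center, and four arms `x – la i – lb i` for `i ∈ {0,1,2,3}`. -/
inductive GadgetV : Type
  | x | s | la : Fin 4 → GadgetV | lb : Fin 4 → GadgetV
  deriving DecidableEq, Fintype

/-- The base (asymmetric) adjacency relation of the gadget graph `H`. -/
def gadgetRel : GadgetV → GadgetV → Prop := fun u v =>
  (u = .x ∧ v = .s) ∨ (∃ i, u = .x ∧ v = .la i) ∨ (∃ i, u = .la i ∧ v = .lb i)

/-- The disjoint union of `m` copies of the gadget graph `H`. -/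
def disjointGadgets (m : ℕ) : SimpleGraph (Fin m × GadgetV) :=
  SimpleGraph.fromRel (fun u v => u.1 = v.1 ∧ gadgetRel u.2 v.2)

/-- Colors for the 3-Partition reduction: `some (j, 0/1/2)` are `red_j`, `blue_j`,
`green_j`, and `none` is the color black. -/
abbrev GColor (m : ℕ) := Option (Fin m × Fin 3)

/-- `S_initial`: for each gadget `j`, two stacks of height `t−1` of each of the three
gadget colors `red_j, blue_j, green_j`. -/
def SinitialG (m t : ℕ) : List (GColor m × ℕ) :=
  (List.finRange m).flatMap (fun j =>
    [(some (j, 0), t-1), (some (j, 0), t-1), (some (j, 1), t-1),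
     (some (j, 1), t-1), (some (j, 2), t-1), (some (j, 2), t-1)])

/-- `S_A`: the black stacks encoding the 3-Partition input values. -/
def SAG (m : ℕ) (a : Fin (3*m) → ℕ) : List (GColor m × ℕ) :=
  (List.finRange (3*m)).map (fun i => ((none : GColor m), a i))

/-- `S_connector`: for each gadget `j`, one stack of height `t−1` of each gadget color. -/
def SconnectorG (m t : ℕ) : List (GColor m × ℕ) :=
  (List.finRange m).flatMap (fun j =>
    [(some (j, 0), t-1), (some (j, 1), t-1), (some (j, 2), t-1)])

/-- `S_final`: for each gadget, four black stacks of height `1`. -/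
def SfinalG (m : ℕ) : List (GColor m × ℕ) :=
  (List.finRange m).flatMap (fun _ =>
    [((none : GColor m), 1), (none, 1), (none, 1), (none, 1)])

/-- The full stack sequence `S = S_initial + S_A + S_connector + S_final`. -/
def SfullG (m : ℕ) (a : Fin (3*m) → ℕ) (t : ℕ) : List (GColor m × ℕ) :=
  SinitialG m t ++ SAG m a ++ SconnectorG m t ++ SfinalG m

end Hexasort

namespace Hexasort

/-- The connected tree-of-gadgets graph `G'`: `m` gadget copies whose `s` vertices are
additionally connected according to the tree `T` (identifying `s` of gadget `j` with
the tree node `t_j`). -/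
def treeGadgets (m : ℕ) (T : SimpleGraph (Fin m)) : SimpleGraph (Fin m × GadgetV) :=
  SimpleGraph.fromRel (fun u v =>
    (u.1 = v.1 ∧ gadgetRel u.2 v.2) ∨
    (u.2 = .s ∧ v.2 = .s ∧ T.Adj u.1 v.1))

end Hexasort


namespace Hexasort

section gen
variable {V C : Type*} [Fintype V] {G : SimpleGraph V} {t : ℕ}

def Run (G : SimpleGraph V) (t : ℕ) : Config V C → List (C × ℕ) → List V → Config V C → Prop
  | δ, [], [], δ' => δ = δ'
  | δ, s :: S, x :: p, δ' => δ x = none ∧ Run G t (place G t δ s x) S p δ'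
  | _, [], _ :: _, _ => False
  | _, _ :: _, [], _ => False

lemma run_iff (S : List (C × ℕ)) : ∀ (δ : Config V C) (p : List V) (δ' : Config V C),
    Run G t δ S p δ' ↔ Legal G t δ S p ∧ play G t δ S p = δ' := by
  induction S with
  | nil =>
    intro δ p δ'
    cases p with
    | nil => simp [Run, play, Legal.nil]
    | cons x p =>
      simp only [Run, false_iff, not_and]
      intro h; cases h
  | cons s S ih =>
    intro δ p δ'
    cases p with
    | nil =>
      simp only [Run, false_iff, not_and]
      intro h; cases h
    | cons x p =>
      simp only [Run, play, ih]
      constructor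
      · rintro ⟨h1, h2, h3⟩
        exact ⟨Legal.cons s S x p h1 h2, h3⟩
      · rintro ⟨h1, h3⟩
        cases h1 with
        | cons _ _ _ _ h1 h2 => exact ⟨h1, h2, h3⟩

lemma emptyable_iff (S : List (C × ℕ)) :
    Emptyable G t S ↔ ∃ p, Run G t (emptyConfig V C) S p (emptyConfig V C) := by
  simp only [Emptyable, run_iff]

lemma run_append (S1 S2 : List (C × ℕ)) : ∀ (δ : Config V C) (p : List V) (δ' : Config V C),
    Run G t δ (S1 ++ S2) p δ' ↔
      ∃ p1 p2 δ1, p = p1 ++ p2 ∧ Run G t δ S1 p1 δ1 ∧ Run G t δ1 S2 p2 δ' := by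
  induction S1 with
  | nil =>
    intro δ p δ'
    constructor
    · intro h
      exact ⟨[], p, δ, rfl, rfl, h⟩
    · rintro ⟨p1, p2, δ1, rfl, h1, h2⟩
      cases p1 with
      | nil => simp only [Run] at h1; subst h1; exact h2
      | cons x p => simp [Run] at h1
  | cons s S1 ih =>
    intro δ p δ'
    constructor
    · intro h
      cases p with
      | nil => simp [Run] at h
      | cons x p =>
        obtain ⟨h0, h⟩ := h
        obtain ⟨p1, p2, δ1, rfl, h1, h2⟩ := (ih _ _ _).1 h
        exact ⟨x :: p1, p2, δ1, rfl, ⟨h0, h1⟩, h2⟩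
    · rintro ⟨p1, p2, δ1, rfl, h1, h2⟩
      cases p1 with
      | nil => simp [Run] at h1
      | cons x p =>
        exact ⟨h1.1, (ih _ _ _).2 ⟨p, p2, δ1, rfl, h1.2, h2⟩⟩

lemma place_other {δ : Config V C} {s : C × ℕ} {x : V} {c : C} (hc : s.1 ≠ c) (hx : δ x = none)
    (v : V) (h : ℕ) : place G t δ s x v = some (c, h) ↔ δ v = some (c, h) := by
  unfold place
  split_ifs with h1 h2 h3
  · subst h1; simp [hx]
  · subst h1; simp [hx, hc]
  · obtain ⟨_, hh, e⟩ := h3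
    simp [e, hc]
  · rfl

lemma run_other {c : C} : ∀ (S : List (C × ℕ)) (δ : Config V C) (p : List V) (δ' : Config V C),
    (∀ s ∈ S, s.1 ≠ c) → Run G t δ S p δ' → ∀ v h, (δ' v = some (c, h) ↔ δ v = some (c, h)) := by
  intro S
  induction S with
  | nil =>
    intro δ p δ' _ h v
    cases p with
    | nil => simp only [Run] at h; subst h; simp
    | cons x p => simp [Run] at h
  | cons s S ih =>
    intro δ p δ' hS h v k
    cases p with
    | nil => simp [Run] at h
    | cons x p =>
      rw [ih _ _ _ (fun s hs => hS s (by simp [hs])) h.2]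
      exact place_other (hS s (by simp)) h.1 v k

lemma neighborSum_zero {δ : Config V C} {c : C} {x : V}
    (h : ∀ v, G.Adj x v → ∀ k, δ v ≠ some (c, k)) : neighborSum G δ c x = 0 := by
  unfold neighborSum
  apply Finset.sum_eq_zero
  intro v hv
  simp only [Finset.mem_filter, Finset.mem_univ, true_and] at hv
  have := h v hv
  rcases e : δ v with _ | ⟨c', k⟩
  · rfl
  · simp only [colorHeight]
    rw [if_neg]
    rintro rfl
    exact this k e

lemma le_neighborSum {δ : Config V C} {c : C} {x v : V} {k : ℕ} (hv : G.Adj x v)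
    (h : δ v = some (c, k)) : k ≤ neighborSum G δ c x := by
  unfold neighborSum
  have : k = colorHeight (δ v) c := by simp [h, colorHeight]
  rw [this]
  exact Finset.single_le_sum (f := fun v => colorHeight (δ v) c) (fun _ _ => Nat.zero_le _)
    (by simp [hv])

lemma place_alone {δ : Config V C} {c : C} {x : V} {k : ℕ} (hk : k < t)
    (h : ∀ v, G.Adj x v → ∀ k, δ v ≠ some (c, k)) :
    place G t δ (c, k) x = Function.update δ x (some (c, k)) := by
  funext v
  unfold place
  simp only [neighborSum_zero h, add_zero, Function.update_apply]
  split_ifs with h1 h2 h3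
  · omega
  · rfl
  · obtain ⟨a, k, b⟩ := h3
    exact absurd b (h v a k)
  · rfl

lemma place_clear {δ : Config V C} {c : C} {x : V} {k : ℕ}
    (h : t ≤ k + neighborSum G δ c x) (v : V) :
    place G t δ (c, k) x v = if v = x ∨ (G.Adj x v ∧ ∃ hh, δ v = some (c, hh)) then none else δ v := by
  unfold place
  simp only [h, if_true]
  split_ifs <;> simp_all

lemma init_pair {δ δ' : Config V C} {c : C} {k : ℕ} {p : List V} (hk : k < t) (hk2 : t ≤ 2 * k)
    (h0 : ∀ v h, δ v ≠ some (c, h)) (hr : Run G t δ [(c, k), (c, k)] p δ') :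
    (∀ v h, δ' v ≠ some (c, h)) ∨
      ∃ u w, u ≠ w ∧ ∀ v h, δ' v = some (c, h) ↔ (v = u ∨ v = w) ∧ h = k := by
  match p, hr with
  | [u, w], ⟨hu, hw, he⟩ =>
    obtain rfl : _ = δ' := he
    rw [place_alone hk (fun v _ k => h0 v k)] at hw ⊢
    have huw : w ≠ u := by
      rintro rfl; simp at hw
    by_cases ha : G.Adj w u
    · left
      intro v h
      have : k ≤ neighborSum G (Function.update δ u (some (c, k))) c w :=
        le_neighborSum ha (by simp)
      rw [place_clear (by omega)]
      split_ifs with h1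
      · simp
      · push Not at h1
        by_cases hvu : v = u
        · subst hvu
          exact absurd (by simp) (h1.2 ha k)
        · simpa [Function.update_apply, hvu] using h0 v h
    · right
      refine ⟨u, w, huw.symm, ?_⟩
      rw [place_alone hk]
      · intro v h
        simp only [Function.update_apply]
        split_ifs with h1 h2
        · simp [h1, eq_comm]
        · simp [h2, eq_comm]
        · simp [h1, h2, h0]
      · intro v hv k
        have : v ≠ u := by rintro rfl; exact ha hv
        simpa [Function.update_apply, this] using h0 v k

lemma init_list {δ δ' : Config V C} {k : ℕ} {p : List V} {L : List C} (hL : L.Nodup)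
    (hk : k < t) (hk2 : t ≤ 2 * k)
    (hr : Run G t δ (L.flatMap fun c => [(c, k), (c, k)]) p δ') (c : C) (hc : c ∈ L)
    (h0 : ∀ v h, δ v ≠ some (c, h)) :
    (∀ v h, δ' v ≠ some (c, h)) ∨
      ∃ u w, u ≠ w ∧ ∀ v h, δ' v = some (c, h) ↔ (v = u ∨ v = w) ∧ h = k := by
  obtain ⟨L1, L2, rfl⟩ := List.append_of_mem hc
  rw [List.flatMap_append, List.flatMap_cons, run_append] at hr
  obtain ⟨p1, p2, δ1, -, hr1, hr⟩ := hr
  rw [run_append] at hr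
  obtain ⟨p3, p4, δ2, -, hr2, hr3⟩ := hr
  have n1 : c ∉ L1 := by
    intro h; rw [List.nodup_append] at hL; exact hL.2.2 c h c (by simp) rfl
  have n2 : c ∉ L2 := by
    intro h; rw [List.nodup_append] at hL; simp_all
  have e1 := run_other (c := c) _ _ _ _ (by
    intro s hs; simp only [List.mem_flatMap] at hs
    obtain ⟨d, hd, hs⟩ := hs
    have : s = (d, k) := by simpa using hs
    subst this; rintro rfl; exact n1 hd) hr1
  have e3 := run_other (c := c) _ _ _ _ (by
    intro s hs; simp only [List.mem_flatMap] at hs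
    obtain ⟨d, hd, hs⟩ := hs
    have : s = (d, k) := by simpa using hs
    subst this; rintro rfl; exact n2 hd) hr3
  have := init_pair hk hk2 (fun v h => by rw [Ne, e1]; exact h0 v h) hr2
  simpa only [Ne, e3] using this

lemma conn_list [Nonempty V] {k : ℕ} (hk : k < t) (L : List C) : ∀ {δ δ' : Config V C} {p : List V}
    (_ : L.Nodup) (_ : Run G t δ (L.map fun c => (c, k)) p δ')
    (_ : ∀ c ∈ L, ∀ v h, δ' v ≠ some (c, h)),
    ∃ (y : C → V) (rk : C → ℕ), ∀ c ∈ L, (∃ v h, δ v = some (c, h)) ∧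
      (∀ v h, δ v = some (c, h) → G.Adj (y c) v) ∧
      (δ (y c) = none ∨ ∃ c' ∈ L, ∃ h, δ (y c) = some (c', h) ∧ rk c' < rk c) := by
  induction L with
  | nil =>
    intro δ δ' p _ hr _
    exact ⟨fun _ => Classical.arbitrary V, fun _ => 0, by simp⟩
  | cons c L ih =>
    intro δ δ' p hL hr hf
    cases p with
    | nil => simp [Run] at hr
    | cons x p =>
      obtain ⟨hx, hr⟩ := hr
      have hcL : c ∉ L := by simp_all
      obtain ⟨y, rk, H⟩ := ih (by simp_all) hr (fun c hc => hf c (by simp [hc]))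
      have e := run_other (c := c) _ _ _ _ (by
        intro s hs; simp only [List.mem_map] at hs
        obtain ⟨d, hd, rfl⟩ := hs
        rintro rfl; exact hcL hd) hr
      have hp : ∀ v h, place G t δ (c, k) x v ≠ some (c, h) := by
        intro v h; rw [Ne, ← e]; exact hf c (by simp) v h
      refine ⟨Function.update y c x, fun d => if d = c then 0 else rk d + 1, ?_⟩
      intro d hd
      by_cases hdc : d = c
      · subst hdc
        refine ⟨?_, ?_, ?_⟩
        · by_contra hcon
          push Not at hcon
          have := hp x k
          rw [place_alone hk (fun v _ k => hcon v k)] at this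
          simp at this
        · intro v h hv
          simp only [Function.update_self]
          by_contra ha
          apply hp v h
          have : v ≠ x := by rintro rfl; simp [hx] at hv
          unfold place
          simp [this, ha, hv]
        · left; simpa using hx
      · have hdL : d ∈ L := by simpa [hdc] using hd
        obtain ⟨H1, H2, H3⟩ := H d hdL
        have po : ∀ d ∈ L, ∀ v h, place G t δ (c, k) x v = some (d, h) ↔ δ v = some (d, h) := by
          intro d hd v h
          exact place_other (by rintro rfl; exact hcL hd) hx v h
        simp only [po d hdL] at H1 H2
        refine ⟨H1, ?_, ?_⟩
        · simpa [Function.update_apply, hdc] using H2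
        · simp only [Function.update_apply, hdc, if_false]
          rcases H3 with H3 | ⟨c', hc', h, e1, e2⟩
          · rcases e : δ (y d) with _ | ⟨c', h⟩
            · left; rfl
            · right
              have : c = c' := by
                by_contra hcc
                rw [← place_other (G := G) (t := t) (s := (c, k)) hcc hx, H3] at e
                simp at e
              exact ⟨c', by simp [this], h, rfl, by simp [this]⟩
          · right
            refine ⟨c', by simp [hc'], h, (po c' hc' _ _).1 e1, ?_⟩
            have : c' ≠ c := by rintro rfl; exact hcL hc'
            simp [this, e2]

lemma sa_list {b : C} (hs : List ℕ) : ∀ {δ δ' : Config V C} {p : List V}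
    (_ : ∀ h ∈ hs, h < t)
    (_ : ∀ u v, G.Adj u v → (∃ c h, c ≠ b ∧ δ u = some (c, h)) ∨ (∃ c h, c ≠ b ∧ δ v = some (c, h)))
    (_ : Run G t δ (hs.map fun h => (b, h)) p δ'),
    p.Nodup ∧ (∀ v ∈ p, δ v = none) ∧ (∀ v ∉ p, δ' v = δ v) ∧
      List.Forall₂ (fun v h => δ' v = some (b, h)) p hs := by
  induction hs with
  | nil =>
    intro δ δ' p _ _ hr
    cases p with
    | nil => simp only [List.map_nil, Run] at hr; subst hr; simp
    | cons x p => simp [Run] at hr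
  | cons h hs ih =>
    intro δ δ' p hh hi hr
    cases p with
    | nil => simp [Run] at hr
    | cons x p =>
      obtain ⟨hx, hr⟩ := hr
      rw [place_alone (hh h (by simp))] at hr
      · obtain ⟨h1, h2, h3, h4⟩ := ih (fun h hm => hh h (by simp [hm])) (by
          intro u v huv
          rcases hi u v huv with ⟨c, k, hc, e⟩ | ⟨c, k, hc, e⟩
          · left
            refine ⟨c, k, hc, ?_⟩
            rw [Function.update_of_ne _, e]
            rintro rfl; simp [hx] at e
          · right
            refine ⟨c, k, hc, ?_⟩
            rw [Function.update_of_ne _, e]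
            rintro rfl; simp [hx] at e) hr
        have hxp : x ∉ p := by
          intro hm
          have := h2 x hm
          simp at this
        refine ⟨by simp [hxp, h1], ?_, ?_, ?_⟩
        · intro v hv
          rcases List.mem_cons.1 hv with rfl | hv'
          · exact hx
          · have := h2 v hv'
            rwa [Function.update_of_ne] at this
            rintro rfl; exact hxp hv'
        · intro v hv
          simp only [List.mem_cons, not_or] at hv
          rw [h3 v hv.2, Function.update_of_ne hv.1]
        · refine List.Forall₂.cons ?_ h4
          rw [h3 x hxp]; simp
      · intro v hv k e
        rcases hi x v hv with ⟨c, k', hc, e'⟩ | ⟨c, k', hc, e'⟩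
        · simp [hx] at e'
        · rw [e] at e'; simp only [Option.some.injEq, Prod.mk.injEq] at e'; exact hc e'.1.symm

noncomputable def cnt (p : List V) (v : V) : ℕ := p.count v

lemma cnt_eq_zero {p : List V} {v : V} (h : cnt p v = 0) : v ∉ p := List.count_eq_zero.1 h

lemma sum_cnt (p : List V) : ∑ v, cnt p v = p.length := by
  have := Multiset.sum_count_eq_card (s := Finset.univ) (m := (p : Multiset V)) (by simp)
  simpa [cnt] using this

lemma region {b : C} (R : Finset V) (n : ℕ) : ∀ {δ δ' : Config V C} {p : List V}
    (_ : Run G t δ (List.replicate n (b, 1)) p δ')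
    (_ : ∀ u ∈ R, ∀ v ∉ R, G.Adj u v → δ v = none ∧ v ∉ p)
    (_ : ∀ v ∈ R, δ' v = none)
    (_ : 0 < ∑ v ∈ R, colorHeight (δ v) b),
    t ≤ ∑ v ∈ R, colorHeight (δ v) b + ∑ v ∈ R, cnt p v := by
  unfold cnt
  induction n with
  | zero =>
    intro δ δ' p hr _ hf hpos
    cases p with
    | nil =>
      simp only [List.replicate_zero, Run] at hr; subst hr
      exfalso
      rw [Finset.sum_eq_zero] at hpos
      · exact absurd hpos (lt_irrefl _)
      · intro v hv; rw [hf v hv]; rfl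
    | cons x p => simp [Run] at hr
  | succ n ih =>
    intro δ δ' p hr hbd hf hpos
    cases p with
    | nil => simp [Run, List.replicate_succ] at hr
    | cons x p =>
      rw [List.replicate_succ] at hr
      obtain ⟨hx, hr⟩ := hr
      have hbd' : ∀ u ∈ R, ∀ v ∉ R, G.Adj u v → place G t δ (b, 1) x v = none ∧ v ∉ p := by
        intro u hu v hv huv
        obtain ⟨h1, h2⟩ := hbd u hu v hv huv
        simp only [List.mem_cons, not_or] at h2
        refine ⟨?_, h2.2⟩
        unfold place
        simp [h1, h2.1]
      have key := ih hr hbd' hf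
      by_cases hxR : x ∈ R
      · have hcount : ∑ v ∈ R, (x :: p).count v = ∑ v ∈ R, p.count v + 1 := by
          simp only [List.count_cons, Finset.sum_add_distrib]
          congr 1
          simp [hxR]
        rw [hcount]
        have hns : neighborSum G δ b x = ∑ y ∈ R.filter (fun y => G.Adj x y), colorHeight (δ y) b := by
          unfold neighborSum
          symm
          apply Finset.sum_subset
          · intro y; simp only [Finset.mem_filter, Finset.mem_univ, true_and]; tauto
          · intro y hy hy'
            simp only [Finset.mem_filter, Finset.mem_univ, true_and] at hy hy'
            have : y ∉ R := fun h => hy' ⟨h, hy⟩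
            rw [(hbd x hxR y this hy).1]; rfl
        by_cases hcl : t ≤ 1 + neighborSum G δ b x
        · have : neighborSum G δ b x ≤ ∑ v ∈ R, colorHeight (δ v) b := by
            rw [hns]; exact Finset.sum_le_sum_of_subset (Finset.filter_subset _ _)
          omega
        · have hpx : colorHeight (place G t δ (b, 1) x x) b = 1 + neighborSum G δ b x := by
            unfold place; simp [hcl, colorHeight]
          have hpos' : 0 < ∑ v ∈ R, colorHeight (place G t δ (b, 1) x v) b := by
            refine lt_of_lt_of_le ?_ (Finset.single_le_sum (f := fun v => colorHeight (place G t δ (b, 1) x v) b) (fun _ _ => Nat.zero_le _) hxR)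
            simp only [hpx]; omega
          have hle : ∑ v ∈ R, colorHeight (place G t δ (b, 1) x v) b ≤
              ∑ v ∈ R, colorHeight (δ v) b + 1 := by
            have e1 : ∀ v ∈ R, colorHeight (place G t δ (b, 1) x v) b
                + (if G.Adj x v then colorHeight (δ v) b else 0) =
                colorHeight (δ v) b + if v = x then 1 + neighborSum G δ b x else 0 := by
              intro v _
              by_cases hvx : v = x
              · subst hvx; rw [hpx]; simp [hx, colorHeight]
              · unfold place
                simp only [hvx, if_false]
                by_cases hA : G.Adj x v
                · rcases e : δ v with _ | ⟨c', k⟩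
                  · simp [colorHeight]
                  · by_cases hc : c' = b
                    · subst hc; simp [hA, colorHeight]
                    · simp [hA, colorHeight, hc]
                · simp [hA]
            have e2 := Finset.sum_congr rfl e1
            rw [Finset.sum_add_distrib, Finset.sum_add_distrib, ← Finset.sum_filter, ← hns] at e2
            simp only [Finset.sum_ite_eq', hxR, if_true] at e2
            omega
          have := key hpos'
          omega
      · have hsame : ∀ v ∈ R, place G t δ (b, 1) x v = δ v := by
          intro v hv
          have hvx : v ≠ x := by rintro rfl; exact hxR hv
          have : ¬ G.Adj x v := by
            intro h
            have := (hbd v hv x hxR h.symm).2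
            simp at this
          unfold place
          simp [hvx, this]
        have hs : ∑ v ∈ R, colorHeight (place G t δ (b, 1) x v) b = ∑ v ∈ R, colorHeight (δ v) b :=
          Finset.sum_congr rfl (fun v hv => by rw [hsame v hv])
        rw [hs] at key
        have hcount : ∑ v ∈ R, (x :: p).count v = ∑ v ∈ R, p.count v := by
          apply Finset.sum_congr rfl
          intro v hv
          rw [List.count_cons_of_ne]
          rintro rfl; exact hxR hv
        rw [hcount]
        exact key hpos

end gen

end Hexasort

namespace Hexasort

section graph
variable {m : ℕ} {T : SimpleGraph (Fin m)}

lemma adj_lb (j : Fin m) (r : Fin 4) (v : Fin m × GadgetV) :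
    (treeGadgets m T).Adj (j, .lb r) v ↔ v = (j, .la r) := by
  obtain ⟨k, g⟩ := v
  cases g <;> simp [treeGadgets, gadgetRel, eq_comm]

lemma adj_la (j : Fin m) (r : Fin 4) (v : Fin m × GadgetV) :
    (treeGadgets m T).Adj (j, .la r) v ↔ v = (j, .x) ∨ v = (j, .lb r) := by
  obtain ⟨k, g⟩ := v
  cases g <;> simp [treeGadgets, gadgetRel, eq_comm]

lemma adj_x (j : Fin m) (v : Fin m × GadgetV) :
    (treeGadgets m T).Adj (j, .x) v ↔ v = (j, .s) ∨ ∃ r, v = (j, .la r) := by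
  obtain ⟨k, g⟩ := v
  cases g <;> simp [treeGadgets, gadgetRel, eq_comm]

lemma adj_s (j : Fin m) (v : Fin m × GadgetV) :
    (treeGadgets m T).Adj (j, .s) v ↔ v = (j, .x) ∨ ∃ k, T.Adj j k ∧ v = (k, .s) := by
  obtain ⟨k, g⟩ := v
  cases g <;> simp [treeGadgets, gadgetRel, eq_comm, SimpleGraph.adj_comm]
  exact fun h => h.ne

lemma sum_gadget (F : GadgetV → ℕ) :
    ∑ g, F g = F .x + F .s + ∑ r, (F (.la r) + F (.lb r)) := by
  have : (Finset.univ : Finset GadgetV) = {.x, .s} ∪ (Finset.univ.image GadgetV.la ∪ Finset.univ.image GadgetV.lb) := by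
    ext g; cases g <;> simp
  rw [this, Finset.sum_union, Finset.sum_union, Finset.sum_image, Finset.sum_image, Finset.sum_add_distrib]
  · simp
  · intro a _ b _ h; simpa using h
  · intro a _ b _ h; simpa using h
  · rw [Finset.disjoint_left]; intro g; simp only [Finset.mem_image]; rintro ⟨r, _, rfl⟩; simp
  · rw [Finset.disjoint_left]; intro g; simp only [Finset.mem_union, Finset.mem_image, Finset.mem_insert, Finset.mem_singleton]
    rintro (rfl | rfl) <;> simp

theorem struct (col : Fin m × GadgetV → Option (Fin m × Fin 3))
    (y : Fin m × Fin 3 → Fin m × GadgetV) (rk : Fin m × Fin 3 → ℕ)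
    (h2 : ∀ c, ∃ u w, u ≠ w ∧ ∀ v, col v = some c ↔ v = u ∨ v = w)
    (hy : ∀ c v, col v = some c → (treeGadgets m T).Adj (y c) v)
    (hr : ∀ c c', col (y c) = some c' → rk c' < rk c) :
    ∃ i0 : Fin m → Fin 4, ∀ j, col (j, .x) ≠ none ∧ col (j, .s) ≠ none ∧
      (∀ r, r ≠ i0 j → col (j, .la r) ≠ none ∧ col (j, .lb r) = none) ∧
      col (j, .lb (i0 j)) ≠ none ∧ ∃ c, y c = (j, .la (i0 j)) := by
  -- partner
  have hpar : ∀ c v, col v = some c → ∃ w, w ≠ v ∧ col w = some c ∧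
      ∀ z, col z = some c → z = v ∨ z = w := by
    intro c v hv
    obtain ⟨u, w, huw, H⟩ := h2 c
    rcases (H v).1 hv with rfl | rfl
    · exact ⟨w, huw.symm, (H w).2 (Or.inr rfl), fun z hz => (H z).1 hz⟩
    · exact ⟨u, huw, (H u).2 (Or.inl rfl), fun z hz => ((H z).1 hz).symm⟩
  have hlb : ∀ j r c, col (j, .lb r) = some c → y c = (j, .la r) ∧ col (j, .x) = some c := by
    intro j r c h
    have h1 := ((adj_lb j r _).1 (hy c _ h).symm)
    refine ⟨h1, ?_⟩
    obtain ⟨w, hw, hc, -⟩ := hpar c _ h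
    have := hy c w hc
    rw [h1, adj_la] at this
    rcases this with rfl | rfl
    · exact hc
    · exact absurd rfl hw
  have hla : ∀ j r c, col (j, .la r) = some c → y c = (j, .x) := by
    intro j r c h
    rcases ((adj_la j r _).1 (hy c _ h).symm) with h1 | h1
    · exact h1
    · exfalso
      obtain ⟨w, hw, hc, -⟩ := hpar c _ h
      have := hy c w hc
      rw [h1, adj_lb] at this
      exact hw this
  have harm : ∀ j r, col (j, .lb r) ≠ none → col (j, .la r) = none := by
    intro j r h
    by_contra h'
    obtain ⟨c, hc⟩ := Option.ne_none_iff_exists'.1 h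
    obtain ⟨d, hd⟩ := Option.ne_none_iff_exists'.1 h'
    obtain ⟨h1, h2⟩ := hlb j r c hc
    have h3 := hla j r d hd
    have := hr c d (by rw [h1, hd])
    have := hr d c (by rw [h3, h2])
    omega
  -- counting
  let ι : Fin m × GadgetV → ℕ := fun v => if col v ≠ none then 1 else 0
  have hι : ∀ v, ι v ≤ 1 := by intro v; simp only [ι]; split_ifs <;> omega
  have hι1 : ∀ v, ι v = 1 → col v ≠ none := by
    intro v; simp only [ι]; split_ifs <;> simp_all
  have hι0 : ∀ v, ι v = 0 → col v = none := by
    intro v; simp only [ι]; split_ifs <;> simp_all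
  have hιarm : ∀ j r, ι (j, .la r) + ι (j, .lb r) ≤ 1 := by
    intro j r
    have := harm j r
    have h1 := hι (j, .la r)
    have h2 := hι (j, .lb r)
    by_cases h : col (j, .lb r) = none
    · simp only [ι, h]; simp; split_ifs <;> omega
    · simp [ι, h, this h]
  have htot : ∑ v, ι v = 6 * m := by
    have : ∀ v, ι v = ∑ c, if col v = some c then 1 else 0 := by
      intro v
      simp only [ι]
      rcases e : col v with _ | c
      · simp
      · simp
    simp only [this]
    rw [Finset.sum_comm]
    have : ∀ c, ∑ v, (if col v = some c then 1 else 0) = 2 := by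
      intro c
      obtain ⟨u, w, huw, H⟩ := h2 c
      rw [← Finset.sum_filter]
      have : Finset.univ.filter (fun v => col v = some c) = {u, w} := by
        ext v; simp [H]
      rw [this]; simp [huw]
    simp only [this]
    simp
    ring
  have hk : ∀ j, ι (j, .x) + ι (j, .s) + ∑ r, (ι (j, .la r) + ι (j, .lb r)) ≤ 6 := by
    intro j
    have h1 := hι (j, .x)
    have h2 := hι (j, .s)
    have : ∑ r, (ι (j, .la r) + ι (j, .lb r)) ≤ ∑ r : Fin 4, 1 :=
      Finset.sum_le_sum (fun r _ => hιarm j r)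
    simp at this
    omega
  have hk6 : ∀ j, ι (j, .x) + ι (j, .s) + ∑ r, (ι (j, .la r) + ι (j, .lb r)) = 6 := by
    rw [Fintype.sum_prod_type] at htot
    simp only [sum_gadget] at htot
    have e : ∑ j : Fin m, 6 = 6 * m := by simp; ring
    rw [← e] at htot
    intro j
    exact (Finset.sum_eq_sum_iff_of_le (fun j _ => hk j)).1 htot j (Finset.mem_univ j)
  have hx : ∀ j, col (j, .x) ≠ none := by
    intro j
    apply hι1
    have := hk6 j
    have h1 := hι (j, .x)
    have h2 := hι (j, .s)
    have : ∑ r, (ι (j, .la r) + ι (j, .lb r)) ≤ ∑ r : Fin 4, 1 :=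
      Finset.sum_le_sum (fun r _ => hιarm j r)
    simp at this
    omega
  have hs : ∀ j, col (j, .s) ≠ none := by
    intro j
    apply hι1
    have := hk6 j
    have h1 := hι (j, .x)
    have h2 := hι (j, .s)
    have : ∑ r, (ι (j, .la r) + ι (j, .lb r)) ≤ ∑ r : Fin 4, 1 :=
      Finset.sum_le_sum (fun r _ => hιarm j r)
    simp at this
    omega
  have harm1 : ∀ j r, ι (j, .la r) + ι (j, .lb r) = 1 := by
    intro j r
    have := hk6 j
    have h1 := hι (j, .x)
    have h2 := hι (j, .s)
    have h4 : ∑ r, (ι (j, .la r) + ι (j, .lb r)) ≤ ∑ r : Fin 4, 1 :=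
      Finset.sum_le_sum (fun r _ => hιarm j r)
    have h5 : ∑ r, (ι (j, .la r) + ι (j, .lb r)) = ∑ r : Fin 4, 1 := by
      simp at h4 ⊢
      omega
    exact (Finset.sum_eq_sum_iff_of_le (fun r _ => hιarm j r)).1 h5 r (Finset.mem_univ r)
  have hla' : ∀ j r, col (j, .lb r) = none → col (j, .la r) ≠ none := by
    intro j r h
    apply hι1
    have := harm1 j r
    simp only [ι, h] at this ⊢
    simpa using this
  have hlb1 : ∀ j r r', col (j, .lb r) ≠ none → col (j, .lb r') ≠ none → r = r' := by
    intro j r r' h h'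
    obtain ⟨c, hc⟩ := Option.ne_none_iff_exists'.1 h
    obtain ⟨d, hd⟩ := Option.ne_none_iff_exists'.1 h'
    obtain ⟨h1, h2⟩ := hlb j r c hc
    obtain ⟨h3, h4⟩ := hlb j r' d hd
    rw [h2] at h4
    obtain rfl : c = d := by simpa using h4
    rw [h1] at h3
    simpa using h3
  -- s of a P-gadget is matched with some la
  have hP : ∀ k i, col (k, .lb i) ≠ none → ∃ r, col (k, .la r) = col (k, .s) := by
    intro k i hi
    by_contra hcon
    push Not at hcon
    have hp : ∀ r, r ≠ i → ∃ r', r' ≠ i ∧ r' ≠ r ∧ col (k, .la r) = col (k, .la r') ∧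
        ∀ r'', col (k, .la r'') = col (k, .la r) → r'' = r ∨ r'' = r' := by
      intro r hri
      have h0 : col (k, .lb r) = none := by
        by_contra h; exact hri (hlb1 k _ _ h hi)
      obtain ⟨c, hc⟩ := Option.ne_none_iff_exists'.1 (hla' k r h0)
      obtain ⟨w, hw, hwc, hw2⟩ := hpar c _ hc
      have := hy c w hwc
      rw [hla k r c hc, adj_x] at this
      rcases this with rfl | ⟨r', rfl⟩
      · exact absurd (hc.trans hwc.symm) (hcon r)
      · refine ⟨r', ?_, ?_, hc.trans hwc.symm, ?_⟩
        · rintro rfl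
          rw [harm k _ hi] at hwc; simp at hwc
        · rintro rfl; exact hw rfl
        · intro r'' h
          have := hw2 _ (h.trans hc)
          simpa using this
    -- choose three distinct arms
    have h3 : ∃ r1 r2 r3 : Fin 4, r1 ≠ i ∧ r2 ≠ i ∧ r3 ≠ i ∧ r1 ≠ r2 ∧ r1 ≠ r3 ∧ r2 ≠ r3 ∧
        ∀ r, r = i ∨ r = r1 ∨ r = r2 ∨ r = r3 := by
      clear * - i
      revert i; decide
    obtain ⟨r1, r2, r3, n1, n2, n3, n12, n13, n23, hall⟩ := h3
    obtain ⟨q1, a1, b1, c1, d1⟩ := hp r1 n1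
    obtain ⟨q2, a2, b2, c2, d2⟩ := hp r2 n2
    obtain ⟨q3, a3, b3, c3, d3⟩ := hp r3 n3
    have e1 := hall q1
    have e2 := hall q2
    have e3 := hall q3
    clear hall hp
    grind
  have hN : ∀ j, ∃ i, col (j, .lb i) ≠ none := by
    by_contra hcon
    push Not at hcon
    let N : Finset (Fin m) := Finset.univ.filter (fun j => ∀ i, col (j, .lb i) = none)
    have hNne : N.Nonempty := by
      obtain ⟨j, hj⟩ := hcon
      exact ⟨j, by simp [N, hj]⟩
    let ρ : Fin m → ℕ := fun j => (col (j, .x)).elim 0 rk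
    obtain ⟨j, hjN, hmax⟩ := Finset.exists_max_image N ρ hNne
    have hj : ∀ i, col (j, .lb i) = none := by simpa [N] using hjN
    obtain ⟨c, hc⟩ := Option.ne_none_iff_exists'.1 (hx j)
    obtain ⟨w, hw, hwc, hw2⟩ := hpar c _ hc
    have hadj := (adj_x j _).1 (hy c _ hc).symm
    rcases hadj with hyc | ⟨r, hyc⟩
    · have := hy c w hwc
      rw [hyc, adj_s] at this
      rcases this with rfl | ⟨k, hjk, rfl⟩
      · exact hw rfl
      · have hk : ∀ i, col (k, .lb i) = none := by
          intro i
          by_contra h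
          obtain ⟨r, hr⟩ := hP k i h
          have := hw2 (k, .la r) (hr.trans hwc)
          simp at this
        obtain ⟨d, hd⟩ := Option.ne_none_iff_exists'.1 (hx k)
        -- y d = s_k
        have hyd : y d = (k, .s) := by
          rcases (adj_x k _).1 (hy d _ hd).symm with h | ⟨r, h⟩
          · exact h
          · exfalso
            obtain ⟨w, hw, hwc, -⟩ := hpar d _ hd
            have := hy d w hwc
            rw [h, adj_la] at this
            rcases this with rfl | rfl
            · exact hw rfl
            · rw [hk] at hwc; simp at hwc
        have h1 := hr d c (by rw [hyd, hwc])
        have h2 := hmax k (by simp [N, hk])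
        simp only [ρ, hc, hd, Option.elim] at h2
        omega
    · have := hy c w hwc
      rw [hyc, adj_la] at this
      rcases this with rfl | rfl
      · exact hw rfl
      · rw [hj] at hwc; simp at hwc
  choose i0 hi0 using hN
  refine ⟨i0, fun j => ⟨hx j, hs j, ?_, hi0 j, ?_⟩⟩
  · intro r hr
    have : col (j, .lb r) = none := by
      by_contra h; exact hr (hlb1 j _ _ h (hi0 j))
    exact ⟨hla' j r this, this⟩
  · obtain ⟨c, hc⟩ := Option.ne_none_iff_exists'.1 (hi0 j)
    exact ⟨c, (hlb j _ c hc).1⟩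

end graph

end Hexasort

namespace Hexasort

section main
variable {m : ℕ} {T : SimpleGraph (Fin m)}

def cols (m : ℕ) : List (GColor m) :=
  (List.finRange m).flatMap (fun j => [some (j, 0), some (j, 1), some (j, 2)])

lemma mem_cols (j : Fin m) (k : Fin 3) : some (j, k) ∈ cols m := by
  simp only [cols, List.mem_flatMap, List.mem_finRange, true_and]
  refine ⟨j, ?_⟩
  fin_cases k <;> simp

lemma none_notMem_cols : (none : GColor m) ∉ cols m := by
  simp [cols]

lemma nodup_cols : (cols m).Nodup := by
  rw [cols, List.nodup_flatMap]
  refine ⟨by intro j _; simp, ?_⟩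
  refine (List.nodup_finRange m).pairwise_of_forall_ne ?_
  intro a _ b _ hab
  simp only [Function.onFun, List.disjoint_left]
  intro c hc
  simp at hc
  rcases hc with rfl | rfl | rfl <;> simp [hab]

lemma Sinitial_eq (t : ℕ) : SinitialG m t = (cols m).flatMap (fun c => [(c, t-1), (c, t-1)]) := by
  simp [SinitialG, cols, List.flatMap_assoc]

lemma Sconn_eq (t : ℕ) : SconnectorG m t = (cols m).map (fun c => (c, t-1)) := by
  simp [SconnectorG, cols, List.map_flatMap]

lemma SA_eq (a : Fin (3*m) → ℕ) : SAG m a =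
    (List.ofFn a).map (fun h => ((none : GColor m), h)) := by
  simp [SAG, List.ofFn_eq_map]

lemma Sfinal_eq : SfinalG m = List.replicate (4*m) ((none : GColor m), 1) := by
  rw [List.eq_replicate_iff]
  constructor
  · simp [SfinalG, List.length_flatMap]; ring
  · simp [SfinalG]

theorem forward (B : ℕ) (a : Fin (3*m) → ℕ)
    (ha : ∀ i, B < 4 * a i ∧ 2 * a i < B)
    (hsum : ∑ i, a i = m * B) [Nonempty (Fin m)]
    (h : Emptyable (treeGadgets m T) (B+4) (SfullG m a (B+4))) :
    ∃ f : Fin (3*m) → Fin m,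
        (∀ j : Fin m, (Finset.univ.filter (fun i => f i = j)).card = 3) ∧
        (∀ j : Fin m, ∑ i ∈ Finset.univ.filter (fun i => f i = j), a i = B) := by
  have hNE : Nonempty (Fin m × GadgetV) := ⟨(Classical.arbitrary _, .x)⟩
  rw [emptyable_iff] at h
  obtain ⟨p, h⟩ := h
  rw [SfullG, run_append] at h
  obtain ⟨_, p4, δ3, -, h, r4⟩ := h
  rw [run_append] at h
  obtain ⟨_, p3, δ2, -, h, r3⟩ := h
  rw [run_append] at h
  obtain ⟨p1, p2, δ1, -, r1, r2⟩ := h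
  rw [Sinitial_eq] at r1
  rw [SA_eq] at r2
  rw [Sconn_eq] at r3
  rw [Sfinal_eq] at r4
  simp only [Nat.add_succ_sub_one] at r1 r3
  -- colour invariance
  have inv2 : ∀ c v k, δ2 v = some (some c, k) ↔ δ1 v = some (some c, k) := fun c =>
    run_other (c := some c) _ _ _ _ (by simp) r2
  have inv4 : ∀ c v k, (emptyConfig (Fin m × GadgetV) (GColor m)) v = some (some c, k) ↔ δ3 v = some (some c, k) := fun c =>
    run_other (c := some c) _ _ _ _ (by simp) r4
  have inv1b : ∀ v k, δ1 v ≠ some (none, k) := by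
    intro v k
    rw [Ne, run_other (c := none) _ _ _ _ _ r1]
    · simp [emptyConfig]
    · intro s hs
      simp only [List.mem_flatMap] at hs
      obtain ⟨d, hd, hs⟩ := hs
      have : s = (d, B + 3) := by simpa using hs
      subst this; rintro rfl; exact none_notMem_cols hd
  have inv3b : ∀ v k, δ3 v = some (none, k) ↔ δ2 v = some (none, k) :=
    run_other (c := none) _ _ _ _ (by
      intro s hs; simp only [List.mem_map] at hs
      obtain ⟨d, hd, rfl⟩ := hs
      rintro rfl; exact none_notMem_cols hd) r3
  have δ3c : ∀ c v k, δ3 v ≠ some (some c, k) := by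
    intro c v k; rw [Ne, ← inv4]; simp [emptyConfig]
  obtain ⟨y, rk, H⟩ := conn_list (by omega) (cols m) nodup_cols r3 (by
    intro c hc v k
    rcases c with _ | c
    · exact absurd hc none_notMem_cols
    · exact δ3c c v k)
  let col : Fin m × GadgetV → Option (Fin m × Fin 3) := fun v => (δ2 v).bind (fun q => q.1)
  have hcol : ∀ v c, col v = some c ↔ ∃ k, δ2 v = some (some c, k) := by
    intro v c
    simp only [col]
    rcases e : δ2 v with _ | ⟨d, k⟩ <;> simp
  obtain ⟨i0, st⟩ := struct (T := T) col (fun c => y (some c)) (fun c => rk (some c)) (by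
      intro c
      obtain ⟨⟨v, k, hv⟩, -, -⟩ := H (some c) (mem_cols c.1 c.2)
      rcases init_list nodup_cols (by omega) (by omega) r1 (some c) (mem_cols c.1 c.2)
        (by intro v h; simp [emptyConfig]) with h | ⟨u, w, huw, h⟩
      · exact absurd ((inv2 c v k).1 hv) (h v k)
      · refine ⟨u, w, huw, fun v => ?_⟩
        rw [hcol]
        simp only [inv2, h]
        simp) (by
      intro c v hv
      obtain ⟨k, hk⟩ := (hcol v c).1 hv
      exact (H (some c) (mem_cols c.1 c.2)).2.1 v k hk) (by
      intro c c' hc'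
      obtain ⟨k, hk⟩ := (hcol _ c').1 hc'
      rcases (H (some c) (mem_cols c.1 c.2)).2.2 with h | ⟨d, hd, k', h, hlt⟩
      · rw [h] at hk; simp at hk
      · rw [h] at hk
        simp only [Option.some.injEq, Prod.mk.injEq] at hk
        rw [← hk.1]; exact hlt)
  have hcol1 : ∀ v, col v ≠ none → ∃ c k, c ≠ none ∧ δ1 v = some (c, k) := by
    intro v hv
    obtain ⟨c, hc⟩ := Option.ne_none_iff_exists'.1 hv
    obtain ⟨k, hk⟩ := (hcol v c).1 hc
    exact ⟨some c, k, by simp, (inv2 c v k).1 hk⟩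
  obtain ⟨nd2, em2, out2, fa2⟩ := sa_list (b := (none : GColor m)) (List.ofFn a) (by
      intro h hm
      rw [List.mem_ofFn] at hm
      obtain ⟨i, rfl⟩ := hm
      have := ha i; omega) (by
      have key : ∀ u v : Fin m × GadgetV, (treeGadgets m T).Adj u v → col u ≠ none ∨ col v ≠ none := by
        rintro ⟨j, g⟩ v huv
        obtain ⟨s1, s2, s3, s4, s5⟩ := st j
        cases g with
        | x => exact Or.inl s1
        | s => exact Or.inl s2
        | la r =>
          by_cases hr : r = i0 j
          · right
            rcases (adj_la _ _ _).1 huv with rfl | rfl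
            · exact s1
            · subst hr
              exact s4
          · exact Or.inl (s3 r hr).1
        | lb r =>
          by_cases hr : r = i0 j
          · left
            rw [hr]; exact s4
          · right
            rw [adj_lb] at huv
            subst huv
            exact (s3 r hr).1
      intro u v huv
      rcases key u v huv with h | h
      · exact Or.inl (hcol1 u h)
      · exact Or.inr (hcol1 v h)) r2
  have len2 : p2.length = 3 * m := by simpa using fa2.length_eq
  let q : Fin (3*m) → Fin m × GadgetV := fun i => p2[i.val]'(by rw [len2]; exact i.2)
  have qinj : Function.Injective q := by
    intro i i' h
    exact Fin.ext ((nd2.getElem_inj_iff).1 h)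
  have q2 : ∀ i, δ2 (q i) = some (none, a i) := by
    intro i
    have := (List.forall₂_iff_get.1 fa2).2 i.val (by rw [len2]; exact i.2) (by simp)
    simpa [q] using this
  have qsurj : ∀ v ∈ p2, ∃ i, q i = v := by
    intro v hv
    obtain ⟨n, hn, rfl⟩ := List.getElem_of_mem hv
    exact ⟨⟨n, by rw [← len2]; exact hn⟩, rfl⟩
  have q1 : ∀ i, δ1 (q i) = none := fun i => em2 _ (List.getElem_mem _)
  have qcol : ∀ i, col (q i) = none := by
    intro i; simp [col, q2]
  have qlb : ∀ i, ∃ r, r ≠ i0 (q i).1 ∧ q i = ((q i).1, .lb r) := by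
    intro i
    have h1 := qcol i
    have h2 := q2 i
    rcases hq : q i with ⟨j, g⟩
    rw [hq] at h1 h2
    obtain ⟨s1, s2, s3, s4, s5⟩ := st j
    cases g with
    | x => exact absurd h1 s1
    | s => exact absurd h1 s2
    | la r =>
      exfalso
      by_cases hr : r = i0 j
      · subst hr
        obtain ⟨c, hc⟩ := s5
        rcases (H (some c) (mem_cols c.1 c.2)).2.2 with h | ⟨d, hd, k', h, hlt⟩
        · rw [hc, h2] at h; simp at h
        · rw [hc, h2] at h
          simp only [Option.some.injEq, Prod.mk.injEq] at h
          rw [← h.1] at hd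
          exact none_notMem_cols hd
      · exact (s3 r hr).1 h1
    | lb r =>
      refine ⟨r, ?_, rfl⟩
      intro h
      simp only at h
      rw [h] at h1
      exact s4 h1
  have black : ∀ v k, δ3 v = some (none, k) → ∃ i, q i = v := by
    intro v k h
    rw [inv3b] at h
    apply qsurj
    by_contra hv
    rw [out2 v hv] at h
    exact inv1b v k h
  have δ3none : ∀ v, (∀ i, q i ≠ v) → δ3 v = none := by
    intro v hv
    rcases e : δ3 v with _ | ⟨c, k⟩
    · rfl
    · rcases c with _ | c
      · obtain ⟨i, hi⟩ := black v k e
        exact absurd hi (hv i)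
      · exact absurd e (δ3c c v k)
  have δ3x : ∀ j, δ3 (j, .x) = none := by
    intro j; apply δ3none; intro i h
    obtain ⟨r, -, e⟩ := qlb i
    rw [h] at e; simp at e
  have δ3s : ∀ j, δ3 (j, .s) = none := by
    intro j; apply δ3none; intro i h
    obtain ⟨r, -, e⟩ := qlb i
    rw [h] at e; simp at e
  have δ3la : ∀ j r, δ3 (j, .la r) = none := by
    intro j r; apply δ3none; intro i h
    obtain ⟨r, -, e⟩ := qlb i
    rw [h] at e; simp at e
  have δ3q : ∀ i, δ3 (q i) = some (none, a i) := fun i => (inv3b _ _).2 (q2 i)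
  -- fibers
  choose ρ hρ using qlb
  have fib : ∀ j, (Finset.univ.filter (fun i => (q i).1 = j)).image ρ ⊆ Finset.univ.erase (i0 j) := by
    intro j r hr
    simp only [Finset.mem_image, Finset.mem_filter, Finset.mem_univ, true_and] at hr
    obtain ⟨i, hi, rfl⟩ := hr
    have := (hρ i).1
    rw [hi] at this
    simp [this]
  have fibinj : ∀ j, Set.InjOn ρ (Finset.univ.filter (fun i => (q i).1 = j)) := by
    intro j i hi i' hi' h
    simp at hi hi'
    apply qinj
    rw [(hρ i).2, (hρ i').2, hi, hi', h]
  have fcard_le : ∀ j, (Finset.univ.filter (fun i => (q i).1 = j)).card ≤ 3 := by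
    intro j
    rw [← Finset.card_image_of_injOn (fibinj j)]
    refine (Finset.card_le_card (fib j)).trans ?_
    simp
  have fcard : ∀ j, (Finset.univ.filter (fun i => (q i).1 = j)).card = 3 := by
    have htot : ∑ j, (Finset.univ.filter (fun i => (q i).1 = j)).card = ∑ j : Fin m, 3 := by
      rw [← Finset.card_eq_sum_card_fiberwise (f := fun i => (q i).1) (s := Finset.univ) (t := Finset.univ) (by simp)]
      simp; ring
    intro j
    exact (Finset.sum_eq_sum_iff_of_le (fun j _ => fcard_le j)).1 htot j (Finset.mem_univ j)
  have hit : ∀ j r, r ≠ i0 j → ∃ i, q i = (j, .lb r) := by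
    intro j r hr
    have : (Finset.univ.filter (fun i => (q i).1 = j)).image ρ = Finset.univ.erase (i0 j) := by
      apply Finset.eq_of_subset_of_card_le (fib j)
      rw [Finset.card_image_of_injOn (fibinj j), fcard]; simp
    have hm : r ∈ Finset.univ.erase (i0 j) := by simp [hr]
    rw [← this] at hm
    simp only [Finset.mem_image, Finset.mem_filter, Finset.mem_univ, true_and] at hm
    obtain ⟨i, hi, rfl⟩ := hm
    exact ⟨i, by rw [(hρ i).2, hi]⟩
  -- final phase
  have len4 : p4.length = 4 * m := by
    have : ∀ (n : ℕ) (δ δ' : Config (Fin m × GadgetV) (GColor m)) (p : List (Fin m × GadgetV)),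
        Run (treeGadgets m T) (B+4) δ (List.replicate n (none, 1)) p δ' → p.length = n := by
      intro n
      induction n with
      | zero => intro δ δ' p h; cases p with
        | nil => rfl
        | cons x p => simp [Run] at h
      | succ n ih => intro δ δ' p h; cases p with
        | nil => simp [Run, List.replicate_succ] at h
        | cons x p => rw [List.replicate_succ] at h; simp [ih _ _ _ h.2]
    exact this _ _ _ _ r4
  have carm : ∀ j r, r ≠ i0 j → 1 ≤ cnt p4 (j, .la r) + cnt p4 (j, .lb r) ∧
      (cnt p4 (j, .x) = 0 → 5 ≤ cnt p4 (j, .la r) + cnt p4 (j, .lb r)) := by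
    intro j r hr
    obtain ⟨i, hi⟩ := hit j r hr
    have hai := ha i
    have hδ := δ3q i
    rw [hi] at hδ
    constructor
    · by_contra hcon
      have h1 : cnt p4 (j, .la r) = 0 := by omega
      have h2 : cnt p4 (j, .lb r) = 0 := by omega
      have := region {((j, .lb r) : Fin m × GadgetV)} _ r4 (by
        intro u hu v hv huv
        rw [Finset.mem_singleton] at hu
        subst hu
        rw [adj_lb] at huv
        subst huv
        exact ⟨δ3la j r, cnt_eq_zero h1⟩) (by simp [emptyConfig]) (by
        simp [hδ, colorHeight]; omega)
      simp [hδ, colorHeight, h2] at this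
      omega
    · intro hx
      have := region {((j, .la r) : Fin m × GadgetV), (j, .lb r)} _ r4 (by
        intro u hu v hv huv
        simp only [Finset.mem_insert, Finset.mem_singleton] at hu hv
        rcases hu with rfl | rfl
        · rw [adj_la] at huv
          rcases huv with rfl | rfl
          · exact ⟨δ3x j, cnt_eq_zero hx⟩
          · simp at hv
        · rw [adj_lb] at huv
          subst huv
          simp at hv) (by simp [emptyConfig]) (by
        rw [Finset.sum_pair (by simp)]
        simp [hδ, colorHeight]; omega)
      rw [Finset.sum_pair (by simp), Finset.sum_pair (by simp)] at this
      simp [hδ, δ3la, colorHeight] at this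
      omega
  have cgad : ∀ j, 4 + cnt p4 (j, .s) ≤ ∑ g, cnt p4 (j, g) := by
    intro j
    rw [sum_gadget (fun g => cnt p4 (j, g))]
    have hsub : ∑ r ∈ Finset.univ.erase (i0 j), (cnt p4 (j, .la r) + cnt p4 (j, .lb r)) ≤
      ∑ r, (cnt p4 (j, .la r) + cnt p4 (j, .lb r)) :=
        Finset.sum_le_sum_of_subset (Finset.subset_univ _)
    by_cases hx : cnt p4 (j, .x) = 0
    · have : ∑ r ∈ Finset.univ.erase (i0 j), 5 ≤ ∑ r ∈ Finset.univ.erase (i0 j), (cnt p4 (j, .la r) + cnt p4 (j, .lb r)) :=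
        Finset.sum_le_sum (fun r hr => (carm j r (by simpa using hr)).2 hx)
      simp at this
      omega
    · have : ∑ r ∈ Finset.univ.erase (i0 j), 1 ≤ ∑ r ∈ Finset.univ.erase (i0 j), (cnt p4 (j, .la r) + cnt p4 (j, .lb r)) :=
        Finset.sum_le_sum (fun r hr => (carm j r (by simpa using hr)).1)
      simp at this
      omega
  have ctot : ∑ j, ∑ g, cnt p4 (j, g) = 4 * m := by
    rw [← Fintype.sum_prod_type (f := fun v => cnt p4 v), ← len4]
    exact sum_cnt p4
  have hsz : ∑ j, cnt p4 (j, GadgetV.s) = 0 := by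
    have := Finset.sum_le_sum (fun j (_ : j ∈ Finset.univ) => cgad j)
    rw [ctot, Finset.sum_add_distrib] at this
    simp at this
    omega
  have hs0 : ∀ j, cnt p4 (j, GadgetV.s) = 0 := by
    intro j
    exact (Finset.sum_eq_zero_iff.1 hsz) j (Finset.mem_univ j)
  have c4 : ∀ j, ∑ g, cnt p4 (j, g) = 4 := by
    intro j
    refine ((Finset.sum_eq_sum_iff_of_le (f := fun _ => 4) (g := fun j => ∑ g, cnt p4 (j, g)) (fun j _ => ?_)).1 ?_ j (Finset.mem_univ j)).symm
    · have := cgad j; omega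
    · rw [ctot]; simp; ring
  have hge : ∀ j, B ≤ ∑ i ∈ Finset.univ.filter (fun i => (q i).1 = j), a i := by
    intro j
    let R : Finset (Fin m × GadgetV) := Finset.univ.image (fun g => (j, g))
    have hR : ∀ v, v ∈ R ↔ v.1 = j := by
      rintro ⟨k, g⟩; simp [R, eq_comm]
    have hW : ∑ v ∈ R, colorHeight (δ3 v) none = ∑ i ∈ Finset.univ.filter (fun i => (q i).1 = j), a i := by
      rw [← Finset.sum_subset (s₁ := (Finset.univ.filter (fun i => (q i).1 = j)).image q)]
      · rw [Finset.sum_image (fun _ _ _ _ h => qinj h)]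
        apply Finset.sum_congr rfl
        intro i _
        simp [δ3q, colorHeight]
      · intro v hv
        simp only [Finset.mem_image, Finset.mem_filter, Finset.mem_univ, true_and] at hv
        obtain ⟨i, hi, rfl⟩ := hv
        rw [hR]; exact hi
      · intro v hv hv'
        rw [δ3none v]
        · rfl
        · rintro i rfl
          apply hv'
          rw [hR] at hv
          exact Finset.mem_image_of_mem _ (by simp [hv])
    have hne : 0 < ∑ i ∈ Finset.univ.filter (fun i => (q i).1 = j), a i := by
      apply Finset.sum_pos
      · intro i _; have := ha i; omega
      · rw [← Finset.card_pos, fcard]; omega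
    have := region R _ r4 (by
      rintro ⟨k, g⟩ hu ⟨k', g'⟩ hv huv
      rw [hR] at hu hv
      simp only at hu hv
      subst hu
      have : g' = .s := by
        cases g with
        | x =>
          rcases (adj_x _ _).1 huv with h | ⟨r, h⟩
          · exact (Prod.mk.inj h).2
          · exact absurd (Prod.mk.inj h).1 hv
        | s =>
          rcases (adj_s _ _).1 huv with h | ⟨r, _, h⟩
          · exact absurd (Prod.mk.inj h).1 hv
          · exact (Prod.mk.inj h).2
        | la r =>
          rcases (adj_la _ _ _).1 huv with h | h
          · exact absurd (Prod.mk.inj h).1 hv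
          · exact absurd (Prod.mk.inj h).1 hv
        | lb r => exact absurd (Prod.mk.inj ((adj_lb _ _ _).1 huv)).1 hv
      subst this
      exact ⟨δ3s _, cnt_eq_zero (hs0 _)⟩) (by simp [emptyConfig]) (by rw [hW]; exact hne)
    rw [hW] at this
    have h4 : ∑ v ∈ R, cnt p4 v = 4 := by
      rw [← c4 j, Finset.sum_image (fun _ _ _ _ h => by simpa using h)]
    rw [h4] at this
    omega
  refine ⟨fun i => (q i).1, fcard, ?_⟩
  have htot : ∑ j : Fin m, B = ∑ j, ∑ i ∈ Finset.univ.filter (fun i => (q i).1 = j), a i := by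
    rw [Finset.sum_fiberwise, hsum]; simp
  intro j
  exact ((Finset.sum_eq_sum_iff_of_le (fun j _ => hge j)).1 htot j (Finset.mem_univ j)).symm

end main

end Hexasort

namespace Hexasort

section gen2
variable {V C : Type*} [Fintype V] {G : SimpleGraph V} {t : ℕ}

lemma run_flatMap {J : Type*} [DecidableEq J] (S : J → List (C × ℕ)) (P : J → List V)
    (cfg : Finset J → Config V C)
    (hstep : ∀ dn j, j ∉ dn → Run G t (cfg dn) (S j) (P j) (cfg (insert j dn))) (L : List J) :
    ∀ dn : Finset J, L.Nodup → (∀ j ∈ L, j ∉ dn) →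
      Run G t (cfg dn) (L.flatMap S) (L.flatMap P) (cfg (dn ∪ L.toFinset)) := by
  induction L with
  | nil => intro dn _ _; simp [Run]
  | cons j L ih =>
    intro dn hL hd
    rw [List.flatMap_cons, List.flatMap_cons, run_append]
    refine ⟨P j, L.flatMap P, _, rfl, hstep dn j (hd j (by simp)), ?_⟩
    have := ih (insert j dn) (by simp_all) (by
      intro k hk
      have : k ≠ j := by rintro rfl; simp_all
      simp [this, hd k (by simp [hk])])
    convert this using 2
    ext k; simp

noncomputable def fillCfg (D : V → C × ℕ) (q : List V) : Config V C :=
  fun v => if v ∈ q then some (D v) else none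

lemma run_fill (D : V → C × ℕ) (hD : ∀ u v, G.Adj u v → (D u).1 ≠ (D v).1) (p : List V) :
    ∀ q : List V, (∀ v ∈ p, (D v).2 < t) → (q ++ p).Nodup →
      Run G t (fillCfg D q) (p.map D) p (fillCfg D (q ++ p)) := by
  induction p with
  | nil => intro q _ _; simp [Run]
  | cons x p ih =>
    intro q ht hn
    have hxq : x ∉ q := by
      intro h; rw [List.nodup_append] at hn; exact hn.2.2 x h x (by simp) rfl
    refine ⟨by simp [fillCfg, hxq], ?_⟩
    have h1 : place G t (fillCfg D q) (D x) x = fillCfg D (q ++ [x]) := by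
      have := place_alone (G := G) (t := t) (δ := fillCfg D q) (c := (D x).1) (x := x) (k := (D x).2)
        (ht x (by simp)) (by
          intro v hv k
          simp only [fillCfg]
          split_ifs
          · intro h
            have := hD x v hv
            simp only [Option.some.injEq] at h
            rw [h] at this; simp at this
          · simp)
      rw [show D x = ((D x).1, (D x).2) from rfl, this]
      funext v
      by_cases hv : v = x
      · subst hv; simp [fillCfg]
      · simp [fillCfg, Function.update_apply, hv]
    rw [h1]
    have := ih (q ++ [x]) (fun v hv => ht v (by simp [hv])) (by simpa using hn)
    simpa using this

end gen2

section back
variable {m : ℕ} {T : SimpleGraph (Fin m)}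

def DD (B : ℕ) (w : Fin m → Fin 4 → ℕ) : Fin m × GadgetV → GColor m × ℕ
  | (j, .x) => (some (j, 0), B + 3)
  | (j, .s) => (some (j, 2), B + 3)
  | (j, .la r) => if r = 0 then (none, 0) else if r = 3 then (some (j, 2), B + 3) else (some (j, 1), B + 3)
  | (j, .lb r) => if r = 0 then (some (j, 0), B + 3) else (none, w j r)

lemma DD_proper (B : ℕ) (w : Fin m → Fin 4 → ℕ) (u v : Fin m × GadgetV)
    (h : (treeGadgets m T).Adj u v) : (DD B w u).1 ≠ (DD B w v).1 := by
  obtain ⟨j, g⟩ := u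
  cases g with
  | x =>
    rcases (adj_x _ _).1 h with rfl | ⟨r, rfl⟩
    · simp [DD]
    · simp only [DD]; split_ifs <;> simp
  | s =>
    rcases (adj_s _ _).1 h with rfl | ⟨r, hr, rfl⟩
    · simp [DD]
    · simp [DD, hr.ne]
  | la r =>
    rcases (adj_la _ _ _).1 h with rfl | rfl
    · simp only [DD]; split_ifs <;> simp
    · simp only [DD]; split_ifs <;> simp
  | lb r =>
    rw [adj_lb] at h; subst h
    simp only [DD]; split_ifs <;> simp

noncomputable def cfgR (B : ℕ) (w : Fin m → Fin 4 → ℕ) (R : Set (GColor m)) :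
    Config (Fin m × GadgetV) (GColor m) :=
  fun v => if v.2 = .la 0 ∨ (DD B w v).1 ∈ R then none else some (DD B w v)

lemma conn_step (B : ℕ) (w : Fin m → Fin 4 → ℕ) (R : Set (GColor m)) (c : GColor m)
    (hc : c ∉ R) (y v0 : Fin m × GadgetV) (hy : cfgR B w R y = none)
    (hall : ∀ v : Fin m × GadgetV, v.2 ≠ .la 0 → (DD B w v).1 = c → (treeGadgets m T).Adj y v)
    (hv0 : v0.2 ≠ .la 0) (hv0' : DD B w v0 = (c, B + 3)) :
    place (treeGadgets m T) (B+4) (cfgR B w R) (c, B+3) y = cfgR B w (insert c R) := by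
  have hle : B + 3 ≤ neighborSum (treeGadgets m T) (cfgR B w R) c y :=
    le_neighborSum (v := v0) (hall v0 hv0 (by rw [hv0'])) (by simp [cfgR, hv0, hv0', hc])
  funext v
  rw [place_clear (by omega)]
  by_cases h1 : v.2 = .la 0
  · simp [cfgR, h1]
  · by_cases h2 : (DD B w v).1 = c
    · have ha := hall v h1 h2
      have : cfgR B w R v = some (c, (DD B w v).2) := by
        subst h2; simp [cfgR, h1, hc]
      rw [if_pos (Or.inr ⟨ha, _, this⟩)]
      simp [cfgR, h2]
    · by_cases h3 : v = y
      · subst h3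
        simp only [true_or, if_true]
        simp only [cfgR] at hy ⊢
        split_ifs at hy with h4
        rw [if_pos]
        rcases h4 with h4 | h4
        · exact Or.inl h4
        · exact Or.inr (Or.inr h4)
      · rw [if_neg]
        · simp [cfgR, h2]
        · rintro (h | ⟨_, hh, h⟩)
          · exact h3 h
          · simp only [cfgR] at h
            split_ifs at h
            simp only [Option.some.injEq] at h
            rw [h] at h2; exact h2 rfl

lemma conn_gadget (B : ℕ) (w : Fin m → Fin 4 → ℕ) (dn : Finset (Fin m)) (j : Fin m) (hj : j ∉ dn) :
    Run (treeGadgets m T) (B+4) (cfgR B w {c | ∃ i ∈ dn, ∃ k, c = some (i, k)})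
      [(some (j, 0), B+3), (some (j, 1), B+3), (some (j, 2), B+3)]
      [(j, .la 0), (j, .x), (j, .x)]
      (cfgR B w {c | ∃ i ∈ insert j dn, ∃ k, c = some (i, k)}) := by
  set R : Set (GColor m) := {c | ∃ i ∈ dn, ∃ k, c = some (i, k)} with hR
  have hn : ∀ k, some (j, k) ∉ R := by
    rintro k ⟨i, hi, k', h⟩
    simp at h
    rw [h.1] at hj; exact hj hi
  have s0 := conn_step (T := T) B w R (some (j, 0)) (hn 0) (j, .la 0) (j, .x) (by simp [cfgR]) (by
    rintro ⟨k, g⟩ h1 h2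
    rw [adj_la]
    cases g with
    | x => simp [DD] at h2; simp [h2]
    | s => simp [DD] at h2
    | la r => simp only [DD] at h2; split_ifs at h2 <;> simp at h2
    | lb r => simp only [DD] at h2; split_ifs at h2 with h <;> simp at h2; simp [h2, h]) (by simp) (by simp [DD])
  have s1 := conn_step (T := T) B w (insert (some (j, 0)) R) (some (j, 1)) (by simp [hn]) (j, .x) (j, .la 1)
    (by simp [cfgR, DD]) (by
    rintro ⟨k, g⟩ h1 h2
    rw [adj_x]
    cases g with
    | x => simp [DD] at h2
    | s => simp [DD] at h2
    | la r => simp only [DD] at h2; split_ifs at h2 <;> simp at h2; simp [h2]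
    | lb r => simp only [DD] at h2; split_ifs at h2 with h <;> simp at h2) (by simp) (by simp [DD])
  have s2 := conn_step (T := T) B w (insert (some (j, 1)) (insert (some (j, 0)) R)) (some (j, 2)) (by simp [hn]) (j, .x) (j, .s)
    (by simp [cfgR, DD]) (by
    rintro ⟨k, g⟩ h1 h2
    rw [adj_x]
    cases g with
    | x => simp [DD] at h2
    | s => simp [DD] at h2; simp [h2]
    | la r => simp only [DD] at h2; split_ifs at h2 <;> simp at h2; simp [h2]
    | lb r => simp only [DD] at h2; split_ifs at h2 with h <;> simp at h2) (by simp) (by simp [DD])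
  refine ⟨by simp [cfgR], ?_⟩
  rw [s0]
  refine ⟨by simp [cfgR, DD], ?_⟩
  rw [s1]
  refine ⟨by simp [cfgR, DD], ?_⟩
  rw [s2]
  show _ = _
  congr 1
  ext c
  rcases c with _ | ⟨i, k⟩
  · simp [hR]
  · simp only [hR, Set.mem_insert_iff, Set.mem_ofPred_eq, Finset.mem_insert, Option.some.injEq, Prod.mk.injEq]
    constructor
    · rintro (h | h | h | ⟨i', h1, k', h2⟩)
      · exact ⟨i, Or.inl h.1, k, rfl, rfl⟩
      · exact ⟨i, Or.inl h.1, k, rfl, rfl⟩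
      · exact ⟨i, Or.inl h.1, k, rfl, rfl⟩
      · exact ⟨i', Or.inr h1, k', h2⟩
    · rintro ⟨i', h1 | h1, k', h2⟩
      · have : k = 0 ∨ k = 1 ∨ k = 2 := by omega
        subst h1
        rcases this with h | h | h <;> simp [h2.1, h]
      · exact Or.inr (Or.inr (Or.inr ⟨i', h1, k', h2⟩))

lemma nsum_la (δ : Config (Fin m × GadgetV) (GColor m)) (c : GColor m) (j : Fin m) (r : Fin 4) :
    neighborSum (treeGadgets m T) δ c (j, .la r) = colorHeight (δ (j, .x)) c + colorHeight (δ (j, .lb r)) c := by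
  unfold neighborSum
  have : Finset.univ.filter (fun y => (treeGadgets m T).Adj (j, .la r) y) = {(j, .x), (j, .lb r)} := by
    ext v; simp [adj_la]
  rw [this, Finset.sum_pair (by simp)]

lemma nsum_x (δ : Config (Fin m × GadgetV) (GColor m)) (c : GColor m) (j : Fin m) :
    neighborSum (treeGadgets m T) δ c (j, .x) = colorHeight (δ (j, .s)) c + ∑ r, colorHeight (δ (j, .la r)) c := by
  unfold neighborSum
  have : Finset.univ.filter (fun y => (treeGadgets m T).Adj (j, .x) y) =
      insert (j, .s) (Finset.univ.image (fun r => (j, .la r))) := by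
    ext v; simp [adj_x, eq_comm]
  rw [this, Finset.sum_insert (by simp), Finset.sum_image (fun _ _ _ _ h => by simpa using h)]

noncomputable def cfgG (w : Fin m → Fin 4 → ℕ) (dn : Finset (Fin m)) (j : Fin m) (A : Finset (Fin 4)) :
    Config (Fin m × GadgetV) (GColor m)
  | (_, .x) => none
  | (_, .s) => none
  | (k, .la r) => if k = j ∧ r ∈ A then some (none, w j r + 1) else none
  | (k, .lb r) => if k ∈ dn ∨ r = 0 ∨ (k = j ∧ r ∈ A) then none else some (none, w k r)

lemma fin_step (B : ℕ) (w : Fin m → Fin 4 → ℕ) (dn : Finset (Fin m)) (j : Fin m) (A : Finset (Fin 4))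
    (r : Fin 4) (hj : j ∉ dn) (hr : r ≠ 0) (hA : r ∉ A) (hw : w j r < B) :
    place (treeGadgets m T) (B+4) (cfgG w dn j A) (none, 1) (j, .la r) = cfgG w dn j (insert r A) := by
  have hs : neighborSum (treeGadgets m T) (cfgG w dn j A) none (j, .la r) = w j r := by
    rw [nsum_la]; simp [cfgG, colorHeight, hj, hr, hA]
  funext v
  unfold place
  simp only [hs]
  rw [if_neg (by omega : ¬ (B + 4 ≤ 1 + w j r))]
  obtain ⟨k, g⟩ := v
  cases g with
  | x => simp [cfgG]
  | s => simp [cfgG]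
  | la r' =>
    by_cases h : k = j
    · subst h
      by_cases h' : r' = r
      · subst h'; simp [cfgG, add_comm]
      · simp [cfgG, h', adj_la]
    · simp [cfgG, h, adj_la]
  | lb r' =>
    by_cases h : k = j
    · subst h
      by_cases h' : r' = r
      · subst h'; simp [cfgG, adj_la, hj, hr, hA]
      · simp [cfgG, h', adj_la]
    · simp [cfgG, h, adj_la]

lemma fin_gadget (B : ℕ) (w : Fin m → Fin 4 → ℕ) (hw : ∀ j r, w j r < B)
    (hsum : ∀ j, w j 1 + w j 2 + w j 3 = B) (dn : Finset (Fin m)) (j : Fin m) (hj : j ∉ dn) :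
    Run (treeGadgets m T) (B+4) (cfgG w dn j ∅) [(none, 1), (none, 1), (none, 1), (none, 1)]
      [(j, .la 1), (j, .la 2), (j, .la 3), (j, .x)] (cfgG w (insert j dn) j ∅) := by
  refine ⟨by simp [cfgG], ?_⟩
  rw [fin_step B w dn j ∅ 1 hj (by simp) (by simp) (hw _ _)]
  refine ⟨by simp [cfgG], ?_⟩
  rw [fin_step B w dn j _ 2 hj (by simp) (by simp) (hw _ _)]
  refine ⟨by simp [cfgG], ?_⟩
  rw [fin_step B w dn j _ 3 hj (by simp) (by simp) (hw _ _)]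
  refine ⟨by simp [cfgG], ?_⟩
  show _ = _
  funext v
  have hs := hsum j
  rw [place_clear]
  · obtain ⟨k, g⟩ := v
    cases g with
    | x => simp [cfgG]
    | s => simp [cfgG]
    | la r =>
      by_cases h : k = j
      · subst h
        simp [cfgG, adj_x]
      · simp [cfgG, h]
    | lb r =>
      by_cases h : k = j
      · subst h
        have : r = 0 ∨ r = 1 ∨ r = 2 ∨ r = 3 := by omega
        rcases this with rfl | rfl | rfl | rfl <;> simp [cfgG]
      · simp [cfgG, h, adj_x]
  · rw [nsum_x]
    simp [Fin.sum_univ_four, cfgG, colorHeight]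
    omega

lemma cfgG_empty (w : Fin m → Fin 4 → ℕ) (dn : Finset (Fin m)) (j j' : Fin m) :
    cfgG w dn j ∅ = cfgG w dn j' ∅ := by
  funext v
  obtain ⟨k, g⟩ := v
  cases g <;> simp [cfgG]

theorem backward (B : ℕ) (hB : 0 < B) (a : Fin (3*m) → ℕ)
    (ha : ∀ i, B < 4 * a i ∧ 2 * a i < B) [Nonempty (Fin m)]
    (f : Fin (3*m) → Fin m)
    (hf : ∀ j : Fin m, (Finset.univ.filter (fun i => f i = j)).card = 3)
    (hfs : ∀ j : Fin m, ∑ i ∈ Finset.univ.filter (fun i => f i = j), a i = B) :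
    Emptyable (treeGadgets m T) (B+4) (SfullG m a (B+4)) := by
  have hfib : ∀ j, Nonempty ({i // f i = j} ≃ Fin 3) := by
    intro j
    refine ⟨Fintype.equivFinOfCardEq ?_⟩
    rw [Fintype.card_subtype]; exact hf j
  let e : ∀ j, {i // f i = j} ≃ Fin 3 := fun j => (hfib j).some
  let E : Fin (3*m) ≃ Fin m × Fin 3 :=
    ((Equiv.sigmaFiberEquiv f).symm.trans (Equiv.sigmaCongrRight e)).trans (Equiv.sigmaEquivProd _ _)
  have hE : ∀ i, (E i).1 = f i := fun i => rfl
  let w : Fin m → Fin 4 → ℕ := fun j => ![0, a (E.symm (j, 0)), a (E.symm (j, 1)), a (E.symm (j, 2))]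
  have hw : ∀ j r, w j r < B := by
    intro j r
    have := fun i => (ha i).2
    have h0 := ha (E.symm (j, 0))
    have h1 := ha (E.symm (j, 1))
    have h2 := ha (E.symm (j, 2))
    fin_cases r <;> simp [w] <;> omega
  have hwsucc : ∀ j (k : Fin 3), w j k.succ = a (E.symm (j, k)) := by
    intro j k; fin_cases k <;> rfl
  have hwsum : ∀ j, w j 1 + w j 2 + w j 3 = B := by
    intro j
    rw [← hfs j, Finset.sum_filter, ← E.symm.sum_comp, Fintype.sum_prod_type]
    have : ∀ j' k, f (E.symm (j', k)) = j' := by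
      intro j' k; rw [← hE]; simp
    simp only [this]
    rw [Finset.sum_eq_single j]
    · simp [Fin.sum_univ_three, w]
    · intro b _ hb; simp [hb]
    · simp
  rw [emptyable_iff]
  let P1 : Fin m → List (Fin m × GadgetV) := fun j => [(j, .x), (j, .lb 0), (j, .la 1), (j, .la 2), (j, .la 3), (j, .s)]
  let p1 := (List.finRange m).flatMap P1
  let p2 : List (Fin m × GadgetV) := (List.finRange (3*m)).map (fun i => ((E i).1, .lb (E i).2.succ))
  have e12 : SinitialG m (B+4) ++ SAG m a = (p1 ++ p2).map (DD B w) := by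
    rw [List.map_append]
    congr 1
    · simp [SinitialG, p1, P1, List.map_flatMap, DD]
    · simp only [SAG, p2, List.map_map]
      apply List.map_congr_left
      intro i _
      simp [DD, hwsucc]
  have hnd : (p1 ++ p2).Nodup := by
    rw [List.nodup_append]
    refine ⟨?_, ?_, ?_⟩
    · rw [List.nodup_flatMap]
      refine ⟨by intro j _; simp [P1], ?_⟩
      refine (List.nodup_finRange m).pairwise_of_forall_ne ?_
      intro b _ c _ hbc
      simp only [Function.onFun, List.disjoint_left]
      rintro ⟨k, g⟩ h h'
      have h1 : k = b := by simp [P1] at h; tauto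
      have h2 : k = c := by simp [P1] at h'; tauto
      exact hbc (h1.symm.trans h2)
    · refine (List.nodup_map_iff ?_).2 (List.nodup_finRange _)
      intro i i' h
      simp at h
      exact E.injective (Prod.ext h.1 h.2)
    · intro u hu v hv
      simp only [p1, P1, List.mem_flatMap] at hu
      simp only [p2, List.mem_map] at hv
      obtain ⟨j, _, hu⟩ := hu
      obtain ⟨i, _, rfl⟩ := hv
      rintro rfl
      simp at hu
  have hmem : ∀ v, v ∈ p1 ++ p2 ↔ v.2 ≠ .la 0 := by
    rintro ⟨j, g⟩
    simp only [p1, P1, p2, List.mem_append, List.mem_flatMap, List.mem_map, List.mem_finRange, true_and]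
    cases g with
    | x => simp
    | s => simp
    | la r =>
      have : r = 0 ∨ r = 1 ∨ r = 2 ∨ r = 3 := by omega
      rcases this with rfl | rfl | rfl | rfl <;> simp
    | lb r =>
      simp only [ne_eq, reduceCtorEq, not_false_eq_true, iff_true]
      refine Fin.cases ?_ (fun k => ?_) r
      · left; exact ⟨j, by simp⟩
      · right; exact ⟨E.symm (j, k), by simp⟩
  have R12 := run_fill (t := B+4) (DD B w) (DD_proper (T := T) B w) (p1 ++ p2) [] (by
    rintro ⟨j, g⟩ _
    have := hw j
    cases g with
    | x => simp [DD]
    | s => simp [DD]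
    | la r => simp only [DD]; split_ifs <;> simp
    | lb r => simp only [DD]; have := this r; split_ifs <;> simp; omega) (by simpa using hnd)
  have R3 := run_flatMap (G := treeGadgets m T) (t := B+4)
    (fun j : Fin m => [(some (j, 0), B+3), (some (j, 1), B+3), (some (j, 2), B+3)])
    (fun j => [(j, .la 0), (j, .x), (j, .x)])
    (fun dn => cfgR B w {c | ∃ i ∈ dn, ∃ k, c = some (i, k)}) (conn_gadget (T := T) B w) (List.finRange m) ∅ (List.nodup_finRange m) (by simp)
  let j0 : Fin m := Classical.arbitrary _
  have R4 := run_flatMap (G := treeGadgets m T) (t := B+4) (fun _ : Fin m => [((none : GColor m), 1), (none, 1), (none, 1), (none, 1)])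
    (fun j => [(j, .la 1), (j, .la 2), (j, .la 3), (j, .x)]) (fun dn => cfgG w dn j0 ∅)
    (fun dn j hj => by
      rw [cfgG_empty w dn j0 j, cfgG_empty w (insert j dn) j0 j]
      exact fin_gadget B w hw hwsum dn j hj) (List.finRange m) ∅ (List.nodup_finRange m) (by simp)
  rw [← e12] at R12
  have c0 : fillCfg (DD B w) [] = emptyConfig (Fin m × GadgetV) (GColor m) := by
    funext v; simp [fillCfg, emptyConfig]
  have c2 : fillCfg (DD B w) ([] ++ (p1 ++ p2)) = cfgR B w {c | ∃ i ∈ (∅ : Finset (Fin m)), ∃ k, c = some (i, k)} := by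
    funext v
    simp only [fillCfg, cfgR, List.nil_append, hmem]
    by_cases h : v.2 = .la 0 <;> simp [h]
  have c3 : cfgR B w {c | ∃ i ∈ ∅ ∪ (List.finRange m).toFinset, ∃ k, c = some (i, k)} = cfgG w ∅ j0 ∅ := by
    funext v
    obtain ⟨j, g⟩ := v
    cases g with
    | x => simp [cfgR, cfgG, DD]
    | s => simp [cfgR, cfgG, DD]
    | la r => 
      by_cases h : r = 0
      · simp [cfgR, cfgG, DD, h]
      · by_cases h' : r = 3 <;> simp [cfgR, cfgG, DD, h, h']
    | lb r => by_cases h : r = 0 <;> simp [cfgR, cfgG, DD, h]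
  have c4 : cfgG w (∅ ∪ (List.finRange m).toFinset) j0 ∅ = emptyConfig (Fin m × GadgetV) (GColor m) := by
    funext v
    obtain ⟨j, g⟩ := v
    cases g <;> simp [cfgG, emptyConfig]
  rw [c0, c2] at R12
  rw [c3] at R3
  simp only [c4] at R4
  rw [SfullG]
  exact ⟨_, (run_append _ _ _ _ _).2 ⟨_, _, _, rfl,
    (run_append _ _ _ _ _).2 ⟨_, _, _, rfl, R12, R3⟩, R4⟩⟩

end back

end Hexasort

namespace Hexasort

/-- the 3-Partition-derived instance on the connected tree-of-gadgets
graph is emptyable iff the indices `{1,…,3m}` can be partitioned into `m` triples whose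
values sum to exactly `B`. -/
theorem statement_9 (m B : ℕ) (hB : 0 < B) (a : Fin (3*m) → ℕ)
    (ha : ∀ i, B < 4 * a i ∧ 2 * a i < B)
    (hsum : ∑ i, a i = m * B)
    (T : SimpleGraph (Fin m)) (hT : T.IsTree) :
    Emptyable (treeGadgets m T) (B+4) (SfullG m a (B+4)) ↔
      ∃ f : Fin (3*m) → Fin m,
        (∀ j : Fin m, (Finset.univ.filter (fun i => f i = j)).card = 3) ∧
        (∀ j : Fin m, ∑ i ∈ Finset.univ.filter (fun i => f i = j), a i = B) := by
  have hne : Nonempty (Fin m) := hT.1.nonempty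
  constructor
  · exact forward B a ha hsum
  · rintro ⟨f, hf, hfs⟩
    exact backward B hB a ha f hf hfs

end Hexasort
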